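/- For every integer x with 0 ≤ x < q, the total number of successful triples (s, r, R) ∈ {0,…,q−1} × {0,1} × D_x is at most 2·q·u_x; equivalently, ε(n,g,x,g) ≥ 1 − u_x/|D_x|. -/

import Mathlib

open Polynomial

/-- The Frobenius orbit of `β`: `{β^(2^j) : 0 ≤ j < n}`. -/
def frobOrbit {L : Type*} [Monoid L] (n : ℕ) (β : L) : Set L :=
  {γ | ∃ j < n, γ = β ^ 2 ^ j}

/-- `u_x`: the number of Frobenius orbits (of elements of `L^×`) contained in `D`. -/
noncomputable def numOrbits {L : Type*} [Monoid L] [Zero L] (n : ℕ) (D : Set L) : ℕ :=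
  Set.ncard {O : Set L | (∃ β : L, β ≠ 0 ∧ O = frobOrbit n β) ∧ O ⊆ D}

/-- The set of successful triples `(s, r, R)`. -/
def successSet (L : Type*) [Field L] [Algebra (ZMod 2) L] (q x : ℕ) (g : L) (D : Set L)
    (Vf : ℕ → Polynomial (ZMod 2)) (Wf : ℕ → L → Polynomial (ZMod 2)) : Set (ℕ × L × L) :=
  {t | t.1 < q ∧ (t.2.1 = 0 ∨ t.2.1 = 1) ∧ t.2.2 ∈ D ∧
    aeval t.2.2 (Vf t.1) ≠ 0 ∧
    aeval t.2.2 (Wf t.1 t.2.1) + (aeval t.2.2 (Vf t.1)) ^ x * (g + t.2.1) = 0}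

/-- The set of non-successful triples `(s, r, R)`. -/
def failSet (L : Type*) [Field L] [Algebra (ZMod 2) L] (q x : ℕ) (g : L) (D : Set L)
    (Vf : ℕ → Polynomial (ZMod 2)) (Wf : ℕ → L → Polynomial (ZMod 2)) : Set (ℕ × L × L) :=
  {t | t.1 < q ∧ (t.2.1 = 0 ∨ t.2.1 = 1) ∧ t.2.2 ∈ D ∧
    ¬ (aeval t.2.2 (Vf t.1) ≠ 0 ∧
       aeval t.2.2 (Wf t.1 t.2.1) + (aeval t.2.2 (Vf t.1)) ^ x * (g + t.2.1) = 0)}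

/-- The failure probability `ε(n,g,x,g)` = (number of non-successful triples)/(2·q·|D_x|). -/
noncomputable def epsVal (L : Type*) [Field L] [Algebra (ZMod 2) L] (q x : ℕ) (g : L)
    (D : Set L) (Vf : ℕ → Polynomial (ZMod 2)) (Wf : ℕ → L → Polynomial (ZMod 2)) : ℚ :=
  ((failSet L q x g D Vf Wf).ncard : ℚ) / ((2 * q * D.ncard : ℕ) : ℚ)

/-- Polynomials over `𝔽₂` commute with iterates of the Frobenius. -/
lemma aeval_pow_two_pow {L : Type*} [Field L] [Algebra (ZMod 2) L] (P : Polynomial (ZMod 2))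
    (β : L) (j : ℕ) : aeval (β ^ 2 ^ j) P = (aeval β P) ^ 2 ^ j := by
  induction j with
  | zero => simp
  | succ j ih => rw [pow_succ, pow_mul, pow_mul, ← ih, ← expand_aeval, ZMod.expand_card, map_pow]

/-- A primitive element `g`, translated by an element of `𝔽₂`, is not fixed by a proper
nontrivial power of the Frobenius. -/
lemma eq_zero_of_add_pow_two_pow_eq {L : Type*} [Field L] [CharP L 2] {n j : ℕ} {g r : L}
    (hg0 : g ≠ 0) (hg : orderOf g = 2 ^ n - 1) (hr : r = 0 ∨ r = 1) (hj : j < n)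
    (h : (g + r) ^ 2 ^ j = g + r) : j = 0 := by
  have hr' : r ^ 2 ^ j = r := by rcases hr with rfl | rfl <;> simp
  rw [add_pow_char_pow, hr', add_left_inj] at h
  have hpos : 1 ≤ 2 ^ j := Nat.one_le_two_pow
  have h1 : g ^ (2 ^ j - 1) = 1 := by
    apply mul_right_cancel₀ hg0
    rw [← pow_succ, Nat.sub_add_cancel hpos, h, one_mul]
  have hdvd := orderOf_dvd_of_pow_eq_one h1
  rw [hg] at hdvd
  by_contra hne
  have h2 : 2 ^ 1 ≤ 2 ^ j := Nat.pow_le_pow_right (by norm_num) (Nat.pos_of_ne_zero hne)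
  have h3 : 2 ^ j < 2 ^ n := Nat.pow_lt_pow_right (by norm_num) hj
  have := Nat.le_of_dvd (by omega) hdvd
  omega

lemma frobOrbit_subset {L : Type*} [Field L] [Algebra (ZMod 2) L] (n x : ℕ)
    (Y : Polynomial (ZMod 2)) {β : L} (hβ : β ≠ 0) (h : aeval β Y = β ^ x) :
    frobOrbit n β ⊆ {β | β ≠ 0 ∧ aeval β Y = β ^ x} := by
  rintro _ ⟨j, -, rfl⟩
  exact ⟨pow_ne_zero _ hβ, by rw [aeval_pow_two_pow, h, pow_right_comm]⟩

lemma ncard_Iio_prod {L : Type*} [Field L] {α : Type*} (q : ℕ) (S : Set α) :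
    (Set.Iio q ×ˢ (({0, 1} : Set L) ×ˢ S)).ncard = 2 * q * S.ncard := by
  rw [Set.ncard_prod, Set.ncard_prod, Set.ncard_pair zero_ne_one, ← Finset.coe_Iio,
    Set.ncard_coe_finset, Nat.card_Iio]
  ring

/-- Within a Frobenius orbit at most one `R` is successful for given `s` and `r`. -/
lemma eq_of_success {L : Type*} [Field L] [Algebra (ZMod 2) L] [CharP L 2] {n j x : ℕ}
    {g r R : L} (hg0 : g ≠ 0) (hg : orderOf g = 2 ^ n - 1) (hr : r = 0 ∨ r = 1) (hj : j < n)
    (V W : Polynomial (ZMod 2)) (hV : aeval R V ≠ 0)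
    (h : aeval R W + aeval R V ^ x * (g + r) = 0)
    (h' : aeval (R ^ 2 ^ j) W + aeval (R ^ 2 ^ j) V ^ x * (g + r) = 0) : j = 0 := by
  rw [CharTwo.add_eq_zero] at h h'
  rw [aeval_pow_two_pow, aeval_pow_two_pow, h, mul_pow, pow_right_comm] at h'
  exact eq_zero_of_add_pow_two_pow_eq hg0 hg hr hj
    (mul_left_cancel₀ (pow_ne_zero _ (pow_ne_zero _ hV)) h')

/-- The total number of successful triples is at most `2·q·u_x`; equivalently
`ε(n,g,x,g) ≥ 1 − u_x/|D_x|`. -/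
theorem stmt5 {L : Type*} [Field L] [Fintype L] [Algebra (ZMod 2) L]
    (n : ℕ) (hn : 2 ≤ n) (hcard : Fintype.card L = 2 ^ n)
    (g : L) (hg : orderOf g = 2 ^ n - 1)
    (x : ℕ) (hx : x < 2 ^ n - 1)
    (Y : Polynomial (ZMod 2)) (hYdeg : Y.degree < (n : WithBot ℕ)) (hYg : aeval g Y = g ^ x)
    (D : Set L) (hD : D = {β | β ≠ 0 ∧ aeval β Y = β ^ x})
    (Vf : ℕ → Polynomial (ZMod 2)) (Wf : ℕ → L → Polynomial (ZMod 2))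
    (hVf : ∀ s < 2 ^ n - 1, (Vf s).degree < (n : WithBot ℕ) ∧ aeval g (Vf s) = g ^ s)
    (hWf : ∀ s < 2 ^ n - 1, ∀ r : L, (r = 0 ∨ r = 1) →
      (Wf s r).degree < (n : WithBot ℕ) ∧ aeval g (Wf s r) = g ^ (x * s) * (g + r)) :
    (successSet L (2 ^ n - 1) x g D Vf Wf).ncard ≤ 2 * (2 ^ n - 1) * numOrbits n D ∧
    epsVal L (2 ^ n - 1) x g D Vf Wf ≥ 1 - (numOrbits n D : ℚ) / (D.ncard : ℚ) := by
  have : CharP L 2 := charP_of_injective_algebraMap (algebraMap (ZMod 2) L).injective 2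
  have hn4 : 2 ^ 2 ≤ 2 ^ n := Nat.pow_le_pow_right (by norm_num) hn
  have hg0 : g ≠ 0 := by
    rintro rfl
    rw [orderOf_zero] at hg
    omega
  have hbound : (successSet L (2 ^ n - 1) x g D Vf Wf).ncard ≤
      2 * (2 ^ n - 1) * numOrbits n D := by
    rw [numOrbits, ← ncard_Iio_prod (L := L)]
    refine Set.ncard_le_ncard_of_injOn (fun t => (t.1, t.2.1, frobOrbit n t.2.2)) ?_ ?_
      ((Set.finite_Iio _).prod ((Set.toFinite _).prod (Set.toFinite _)))
    · rintro ⟨s, r, R⟩ ⟨hs, hr, hR, -, -⟩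
      simp only [hD, Set.mem_ofPred_eq] at hR
      refine ⟨hs, hr, ⟨R, hR.1, rfl⟩, ?_⟩
      rw [hD]
      exact frobOrbit_subset n x Y hR.1 hR.2
    · rintro ⟨s, r, R⟩ ⟨-, hr, -, hV, h⟩ ⟨s', r', R'⟩ ⟨-, -, -, -, h'⟩ heq
      simp only [Prod.mk.injEq] at heq
      obtain ⟨rfl, rfl, hO⟩ := heq
      have hmem : R' ∈ frobOrbit n R := hO ▸ ⟨0, by omega, by simp⟩
      obtain ⟨j, hj, rfl⟩ := hmem
      obtain rfl := eq_of_success hg0 hg hr hj _ _ hV h h'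
      simp
  refine ⟨hbound, ?_⟩
  have hunion : successSet L (2 ^ n - 1) x g D Vf Wf ∪ failSet L (2 ^ n - 1) x g D Vf Wf =
      Set.Iio (2 ^ n - 1) ×ˢ (({0, 1} : Set L) ×ˢ D) := by
    ext ⟨s, r, R⟩
    simp only [successSet, failSet, Set.mem_union, Set.mem_ofPred_eq, Set.mem_prod, Set.mem_Iio,
      Set.mem_insert_iff, Set.mem_singleton_iff]
    tauto
  have hfin : (Set.Iio (2 ^ n - 1) ×ˢ (({0, 1} : Set L) ×ˢ D)).Finite :=
    (Set.finite_Iio _).prod ((Set.toFinite _).prod (Set.toFinite _))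
  have hdisj : Disjoint (successSet L (2 ^ n - 1) x g D Vf Wf)
      (failSet L (2 ^ n - 1) x g D Vf Wf) :=
    Set.disjoint_left.2 fun _ hs hf => hf.2.2.2 hs.2.2.2
  have htotal := Set.ncard_union_eq hdisj
    (hfin.subset (hunion ▸ Set.subset_union_left)) (hfin.subset (hunion ▸ Set.subset_union_right))
  rw [hunion, ncard_Iio_prod] at htotal
  have hDpos : 0 < D.ncard := by
    rw [Set.ncard_pos]
    exact ⟨g, by rw [hD]; exact ⟨hg0, hYg⟩⟩
  have hqpos : 0 < 2 ^ n - 1 := by omega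
  rw [epsVal]
  generalize 2 ^ n - 1 = q at *
  have htotal' : (2 * q * D.ncard : ℚ) = (successSet L q x g D Vf Wf).ncard +
      (failSet L q x g D Vf Wf).ncard := by exact_mod_cast htotal
  have hbound' : ((successSet L q x g D Vf Wf).ncard : ℚ) ≤ 2 * q * numOrbits n D := by
    exact_mod_cast hbound
  have hD' : (0 : ℚ) < D.ncard := by exact_mod_cast hDpos
  have hq' : (0 : ℚ) < q := by exact_mod_cast hqpos
  push_cast
  rw [ge_iff_le, le_div_iff₀ (by positivity)]
  have hcancel : (1 - (numOrbits n D : ℚ) / D.ncard) * (2 * q * D.ncard) =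
      2 * q * D.ncard - 2 * q * numOrbits n D := by
    field_simp
  linarith
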